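/- Shift rule for k-lcp when the first letters agree: let T be a string of length n, let k ≥ 0, let i < j be positions with ℓ = k-lcp(i,j) ≥ 1. If T[i] = T[j], or if j + ℓ − 1 = n, then k-lcp(i+1, j+1) = ℓ − 1. -/

import Mathlib

/-- The length-`m` window of the string `T` (with 1-based positions given by a
function `ℕ → α`) starting at position `i`, i.e. `T[i..i+m-1]`. -/
def win {α : Type*} (T : ℕ → α) (i m : ℕ) : Fin m → α :=
  fun p => T (i + p)

/-- Hamming distance between two strings of equal length `m`. -/
def hamm {α : Type*} [DecidableEq α] {m : ℕ} (x y : Fin m → α) : ℕ :=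
  (Finset.univ.filter fun p => x p ≠ y p).card

/-- `k`-lcp of suffixes at positions `i` and `j` of a string of length `n`:
the largest `ℓ` with `0 ≤ ℓ ≤ n + 1 - max i j` such that
`d_H(T_i^ℓ, T_j^ℓ) ≤ k`. -/
def klcp {α : Type*} [DecidableEq α] (T : ℕ → α) (n k i j : ℕ) : ℕ :=
  ((Finset.Iic (n + 1 - max i j)).filter
      fun ℓ => hamm (win T i ℓ) (win T j ℓ) ≤ k).max'
    ⟨0, Finset.mem_filter.mpr ⟨Finset.mem_Iic.mpr (Nat.zero_le _), by simp [hamm]⟩⟩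


theorem hamm_win_eq_sum {α : Type*} [DecidableEq α] (T : ℕ → α) (i j m : ℕ) :
    hamm (win T i m) (win T j m) = ∑ p : Fin m, if T (i + p) = T (j + p) then 0 else 1 :=
  (Finset.card_filter _ _).trans (Finset.sum_congr rfl fun _ _ => ite_not _ _ _)

/-- Prepending a letter to both windows adds one mismatch exactly when the letters differ. -/
theorem hamm_win_succ {α : Type*} [DecidableEq α] (T : ℕ → α) (i j m : ℕ) :
    hamm (win T i (m + 1)) (win T j (m + 1)) =
      (if T i = T j then 0 else 1) + hamm (win T (i + 1) m) (win T (j + 1) m) := by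
  rw [hamm_win_eq_sum, hamm_win_eq_sum, Fin.sum_univ_succ]
  simp [add_assoc, add_comm 1]

theorem klcp_eq_iff {α : Type*} [DecidableEq α] (T : ℕ → α) (n k i j ℓ : ℕ) :
    klcp T n k i j = ℓ ↔
      (ℓ ≤ n + 1 - max i j ∧ hamm (win T i ℓ) (win T j ℓ) ≤ k) ∧
        ∀ m ≤ n + 1 - max i j, hamm (win T i m) (win T j m) ≤ k → m ≤ ℓ := by
  refine (Finset.max'_eq_iff _ _ _).trans ?_
  simp only [Finset.mem_filter, Finset.mem_Iic, and_imp]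

/-- shift rule for the `k`-lcp when the first letters agree:
if `ℓ = k-lcp(i,j) ≥ 1` and `T[i] = T[j]` or `j + ℓ - 1 = n`, then
`k-lcp(i+1, j+1) = ℓ - 1`. -/
theorem klcp_shift_agree {α : Type*} [DecidableEq α] (T : ℕ → α) (n k i j ℓ : ℕ)
    (hi : 1 ≤ i) (hij : i < j) (hj : j ≤ n)
    (hℓ : ℓ = klcp T n k i j) (hℓ1 : 1 ≤ ℓ)
    (hcase : T i = T j ∨ j + ℓ - 1 = n) :
    klcp T n k (i + 1) (j + 1) = ℓ - 1 := by
  rw [eq_comm, klcp_eq_iff] at hℓ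
  obtain ⟨⟨hle, hham⟩, hmax⟩ := hℓ
  obtain ⟨r, rfl⟩ : ∃ r, ℓ = r + 1 := ⟨ℓ - 1, by omega⟩
  rw [hamm_win_succ] at hham
  rw [klcp_eq_iff, Nat.add_sub_cancel]
  refine ⟨⟨by omega, by omega⟩, fun m hm hmk => ?_⟩
  rcases hcase with heq | hend
  · have := hmax (m + 1) (by omega) (by rw [hamm_win_succ, if_pos heq]; omega)
    omega
  · omega
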